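/- Let 𝔤 = 𝒜₄,₁₂ be the 4-dimensional real Lie algebra with brackets [e₁,e₃] = e₁, [e₂,e₃] = e₂, [e₁,e₄] = −e₂, [e₂,e₄] = e₁. Then for every inner product g on 𝔤 and every alternating 2-form F on 𝔤 such that (g,F) is a solution of the Einstein–Maxwell equations, the metric g is Einstein. -/

import Mathlib

open scoped BigOperators

noncomputable section

/-- The underlying vector space `ℝ⁴` of the 4-dimensional Lie algebra. -/
abbrev V4 : Type := Fin 4 → ℝ

/-- The standard basis `e₁, e₂, e₃, e₄` (0-indexed). -/
def ee (i : Fin 4) : V4 := Pi.single i 1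

/-- `g` is an inner product: a positive-definite symmetric bilinear form. -/
structure IsInnerProduct (g : V4 → V4 → ℝ) : Prop where
  symm : ∀ x y, g x y = g y x
  add_left : ∀ x y z, g (x + y) z = g x z + g y z
  smul_left : ∀ (a : ℝ) (x y : V4), g (a • x) y = a * g x y
  pos : ∀ x : V4, x ≠ 0 → 0 < g x x

/-- `F` is an alternating bilinear 2-form. -/
structure IsAltForm (F : V4 → V4 → ℝ) : Prop where
  skew : ∀ x y, F x y = - F y x
  add_left : ∀ x y z, F (x + y) z = F x z + F y z
  smul_left : ∀ (a : ℝ) (x y : V4), F (a • x) y = a * F x y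

/-- Chevalley–Eilenberg differential of a 2-form with respect to the bracket `br`:
`dF(x,y,z) = −F([x,y],z) + F([x,z],y) − F([y,z],x)`. -/
def cdiff (br : V4 → V4 → V4) (F : V4 → V4 → ℝ) (x y z : V4) : ℝ :=
  - F (br x y) z + F (br x z) y - F (br y z) x

/-- A 2-form is closed if its Chevalley–Eilenberg differential vanishes. -/
def IsClosedForm (br : V4 → V4 → V4) (F : V4 → V4 → ℝ) : Prop :=
  ∀ x y z, cdiff br F x y z = 0

/-- The Gram matrix of a bilinear form in the standard basis. -/
def gram (g : V4 → V4 → ℝ) : Matrix (Fin 4) (Fin 4) ℝ :=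
  Matrix.of fun i j => g (ee i) (ee j)

/-- The inverse Gram matrix. -/
def ginv (g : V4 → V4 → ℝ) : Matrix (Fin 4) (Fin 4) ℝ := (gram g)⁻¹

/-- The inner product induced by `g` on 2-forms:
`⟨α,β⟩ = (1/2) Σ g^{ik} g^{jl} α_{ij} β_{kl}`. -/
def formInner (g : V4 → V4 → ℝ) (α β : V4 → V4 → ℝ) : ℝ :=
  (1 / 2) * ∑ i, ∑ j, ∑ k, ∑ l,
    ginv g i k * ginv g j l * α (ee i) (ee j) * β (ee k) (ee l)

/-- The volume form of `g` for the orientation `e¹∧e²∧e³∧e⁴`. -/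
def vol (g : V4 → V4 → ℝ) (x y z w : V4) : ℝ :=
  Real.sqrt (gram g).det * Matrix.det (Matrix.of fun i j => ![x, y, z, w] i j)

/-- The wedge product of two 2-forms, as a 4-form. -/
def wedge22 (α β : V4 → V4 → ℝ) (x y z w : V4) : ℝ :=
  α x y * β z w - α x z * β y w + α x w * β y z
    + α z w * β x y - α y w * β x z + α y z * β x w

/-- `sF` is the Hodge star `⋆F` of `F` with respect to `g` and the orientation
`e¹∧e²∧e³∧e⁴`: it is the 2-form with `α ∧ sF = ⟨α,F⟩_g vol_g` for all 2-forms `α`. -/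
def IsHodgeStar (g : V4 → V4 → ℝ) (F sF : V4 → V4 → ℝ) : Prop :=
  IsAltForm sF ∧
    ∀ α : V4 → V4 → ℝ, IsAltForm α → ∀ x y z w,
      wedge22 α sF x y z w = formInner g α F * vol g x y z w

/-- `F` is co-closed: `d(⋆F) = 0`. -/
def IsCoclosed (br : V4 → V4 → V4) (g F : V4 → V4 → ℝ) : Prop :=
  ∃ sF, IsHodgeStar g F sF ∧ IsClosedForm br sF

/-- Koszul expression: `g(∇ₓy, z) = (1/2)(g([x,y],z) − g([y,z],x) + g([z,x],y))`. -/
def koszul (br : V4 → V4 → V4) (g : V4 → V4 → ℝ) (x y z : V4) : ℝ :=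
  (1 / 2) * (g (br x y) z - g (br y z) x + g (br z x) y)

/-- The Levi-Civita product `∇ₓ y`, i.e. the unique vector with
`g(∇ₓy, z) = koszul x y z` for all `z` (computed via the inverse Gram matrix). -/
def LC (br : V4 → V4 → V4) (g : V4 → V4 → ℝ) (x y : V4) : V4 :=
  fun m => ∑ k, koszul br g x y (ee k) * ginv g k m

/-- Curvature `R(x,y)z = ∇ₓ∇_y z − ∇_y∇ₓ z − ∇_{[x,y]} z`. -/
def curv (br : V4 → V4 → V4) (g : V4 → V4 → ℝ) (x y z : V4) : V4 :=
  LC br g x (LC br g y z) - LC br g y (LC br g x z) - LC br g (br x y) z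

/-- Ricci tensor `Ric(x,y) = Σᵢ g(R(vᵢ,x)y, vᵢ)` for a `g`-orthonormal basis `(vᵢ)`,
i.e. the trace of the endomorphism `z ↦ R(z,x)y`. -/
def ricci (br : V4 → V4 → V4) (g : V4 → V4 → ℝ) (x y : V4) : ℝ :=
  ∑ i, curv br g (ee i) x y i

/-- Scalar curvature: the `g`-trace of the Ricci tensor. -/
def scal (br : V4 → V4 → V4) (g : V4 → V4 → ℝ) : ℝ :=
  ∑ a, ∑ b, ginv g a b * ricci br g (ee a) (ee b)

/-- Trace-free Ricci tensor `Ric₀ = Ric − (s/4) g`. -/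
def ricci0 (br : V4 → V4 → V4) (g : V4 → V4 → ℝ) (x y : V4) : ℝ :=
  ricci br g x y - (scal br g / 4) * g x y

/-- `g` is Einstein: `Ric₀ = 0`. -/
def IsEinstein (br : V4 → V4 → V4) (g : V4 → V4 → ℝ) : Prop :=
  ∀ x y, ricci0 br g x y = 0

/-- The endomorphism `F̂` with `g(F̂x, y) = F(x,y)` (computed via the inverse Gram matrix). -/
def fhat (g F : V4 → V4 → ℝ) (x : V4) : V4 :=
  fun m => ∑ k, F x (ee k) * ginv g k m

/-- `[F∘F]₀(x,y) = g(F̂(F̂x), y) − (1/4) tr(F̂∘F̂) g(x,y)`. -/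
def FF0 (g F : V4 → V4 → ℝ) (x y : V4) : ℝ :=
  g (fhat g F (fhat g F x)) y
    - (1 / 4) * (∑ i, fhat g F (fhat g F (ee i)) i) * g x y

/-- `(g, F)` is a solution of the Einstein--Maxwell equations:
`dF = 0`, `d(⋆F) = 0`, and `Ric₀ = −[F∘F]₀`. -/
def IsEMSolution (br : V4 → V4 → V4) (g F : V4 → V4 → ℝ) : Prop :=
  IsClosedForm br F ∧ IsCoclosed br g F ∧ ∀ x y, ricci0 br g x y = - FF0 g F x y

/-- Nijenhuis tensor `N_J(x,y) = [Jx,Jy] − J[Jx,y] − J[x,Jy] − [x,y]`. -/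
def nijenhuis (br : V4 → V4 → V4) (J : V4 →ₗ[ℝ] V4) (x y : V4) : V4 :=
  br (J x) (J y) - J (br (J x) y) - J (br x (J y)) - br x y

/-- The Lie algebra `𝒜₄,₁₂`: `[e₁,e₃] = e₁`, `[e₂,e₃] = e₂`, `[e₁,e₄] = −e₂`, `[e₂,e₄] = e₁`. -/
def brA412 : V4 → V4 → V4 := fun x y =>
  ((x 0 * y 2 - x 2 * y 0) + (x 1 * y 3 - x 3 * y 1)) • ee 0
    + ((x 1 * y 2 - x 2 * y 1) - (x 0 * y 3 - x 3 * y 0)) • ee 1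

open scoped Matrix

/-- The metric-free dual of a skew `4 × 4` matrix, the coordinate form of the Hodge star. -/
def skewDual (A : Matrix (Fin 4) (Fin 4) ℝ) : Matrix (Fin 4) (Fin 4) ℝ :=
  !![0, A 2 3, -A 1 3, A 1 2;
     -A 2 3, 0, A 0 3, -A 0 2;
     A 1 3, -A 0 3, 0, A 0 1;
     -A 1 2, A 0 2, -A 0 1, 0]

/-- The Pfaffian of a skew `4 × 4` matrix. -/
def pfaff (A : Matrix (Fin 4) (Fin 4) ℝ) : ℝ :=
  A 0 1 * A 2 3 - A 0 2 * A 1 3 + A 0 3 * A 1 2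

lemma skewDual_smul (c : ℝ) (A : Matrix (Fin 4) (Fin 4) ℝ) :
    skewDual (c • A) = c • skewDual A := by
  ext i j
  fin_cases i <;> fin_cases j <;> simp [skewDual]

lemma skewDual_add (A B : Matrix (Fin 4) (Fin 4) ℝ) :
    skewDual (A + B) = skewDual A + skewDual B := by
  ext i j
  fin_cases i <;> fin_cases j <;> simp [skewDual] <;> ring

lemma eq_of_skew {A : Matrix (Fin 4) (Fin 4) ℝ} (hA : Aᵀ = -A) :
    A = !![0, A 0 1, A 0 2, A 0 3;
           -A 0 1, 0, A 1 2, A 1 3;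
           -A 0 2, -A 1 2, 0, A 2 3;
           -A 0 3, -A 1 3, -A 2 3, 0] := by
  have h : ∀ i j, A j i = -A i j := fun i j => congrFun (congrFun hA i) j
  have hd : ∀ i, A i i = 0 := fun i => by linarith [h i i]
  ext i j
  fin_cases i <;> fin_cases j <;> simp [hd] <;> exact h _ _

lemma skewDual_skewDual {A : Matrix (Fin 4) (Fin 4) ℝ} (hA : Aᵀ = -A) :
    skewDual (skewDual A) = A := by
  conv_rhs => rw [eq_of_skew hA]
  ext i j
  fin_cases i <;> fin_cases j <;> simp [skewDual]

lemma skewDual_mul_self {A : Matrix (Fin 4) (Fin 4) ℝ} (hA : Aᵀ = -A) :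
    skewDual A * A = -pfaff A • (1 : Matrix (Fin 4) (Fin 4) ℝ) := by
  rw [eq_of_skew hA]
  ext i j
  fin_cases i <;> fin_cases j <;>
    simp [skewDual, pfaff, Matrix.mul_apply, Fin.sum_univ_four] <;> ring

set_option maxHeartbeats 2000000 in
lemma transpose_mul_skewDual_mul {A : Matrix (Fin 4) (Fin 4) ℝ} (hA : Aᵀ = -A)
    (P : Matrix (Fin 4) (Fin 4) ℝ) :
    Pᵀ * skewDual (P * A * Pᵀ) * P = P.det • skewDual A := by
  rw [eq_of_skew hA]
  ext i j
  fin_cases i <;> fin_cases j <;>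
    simp [skewDual, Matrix.mul_apply, Matrix.det_succ_row_zero,
      Fin.sum_univ_succ, Fin.succAbove] <;> ring

lemma transpose_sandwich {P A : Matrix (Fin 4) (Fin 4) ℝ} (hP : Pᵀ = P) (hA : Aᵀ = -A) :
    (P * A * P)ᵀ = -(P * A * P) := by
  simp [Matrix.transpose_mul, hP, hA, Matrix.mul_assoc]

/-- An eigenform of the Hodge star, `⋆E = tE`, squares to a multiple of the metric. -/
lemma mul_inv_mul_self_of_star_eq {G E : Matrix (Fin 4) (Fin 4) ℝ} (hG : G.PosDef) {t : ℝ}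
    (hE : Eᵀ = -E) (h : t • E = √G.det • skewDual (G⁻¹ * E * G⁻¹)) :
    E * G⁻¹ * E = -(t * (√G.det)⁻¹ * pfaff E) • G := by
  have hs : √G.det ≠ 0 := (Real.sqrt_pos.2 hG.det_pos).ne'
  have hu : IsUnit G.det := hG.det_pos.ne'.isUnit
  have hP : (G⁻¹)ᵀ = G⁻¹ := hG.inv.isHermitian
  have h1 : t • skewDual E = √G.det • (G⁻¹ * E * G⁻¹) := by
    rw [← skewDual_smul, h, skewDual_smul, skewDual_skewDual (transpose_sandwich hP hE)]
  have h2 : G⁻¹ * E * G⁻¹ = ((√G.det)⁻¹ * t) • skewDual E := by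
    rw [mul_smul, h1, smul_smul, inv_mul_cancel₀ hs, one_smul]
  calc E * G⁻¹ * E = G * (G⁻¹ * E * G⁻¹) * E := by
        simp only [Matrix.mul_assoc, Matrix.mul_nonsing_inv_cancel_left _ _ hu]
    _ = _ := by
        rw [h2, Matrix.mul_smul, Matrix.smul_mul, Matrix.mul_assoc, skewDual_mul_self hE,
          Matrix.mul_smul, Matrix.mul_one, smul_smul]
        congr 1
        ring

/-- The Hodge star is an involution on 2-forms in dimension four. -/
lemma hodge_involutive {G A B : Matrix (Fin 4) (Fin 4) ℝ} (hG : G.PosDef) (hA : Aᵀ = -A)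
    (h : B = √G.det • skewDual (G⁻¹ * A * G⁻¹)) :
    A = √G.det • skewDual (G⁻¹ * B * G⁻¹) := by
  have hP : (G⁻¹)ᵀ = G⁻¹ := hG.inv.isHermitian
  have h1 := transpose_mul_skewDual_mul hA G⁻¹
  rw [hP] at h1
  rw [h, Matrix.mul_smul, Matrix.smul_mul, h1, skewDual_smul, skewDual_smul, skewDual_skewDual hA,
    smul_smul, smul_smul, Real.mul_self_sqrt hG.det_pos.le, Matrix.det_nonsing_inv,
    Ring.mul_inverse_cancel _ hG.det_pos.ne'.isUnit, one_smul]

/-- A self-dual form with nonpositive Pfaffian vanishes. -/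
lemma eq_zero_of_star_eq_of_pfaff_nonpos {G E : Matrix (Fin 4) (Fin 4) ℝ} (hG : G.PosDef)
    (hE : Eᵀ = -E) (h : E = √G.det • skewDual (G⁻¹ * E * G⁻¹)) (hp : pfaff E ≤ 0) : E = 0 := by
  have h1 := mul_inv_mul_self_of_star_eq hG (t := 1) hE (by rwa [one_smul])
  have hs : 0 ≤ (√G.det)⁻¹ := inv_nonneg.2 (Real.sqrt_nonneg _)
  have key : ∀ x : Fin 4 → ℝ, E *ᵥ x = 0 := by
    intro x
    by_contra hx
    have h2 := hG.inv.dotProduct_mulVec_pos hx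
    have h3 : (E *ᵥ x) ⬝ᵥ (G⁻¹ *ᵥ (E *ᵥ x)) = -(x ⬝ᵥ ((E * G⁻¹ * E) *ᵥ x)) := by
      have h6 : E *ᵥ x = -(x ᵥ* E) := by
        rw [← Matrix.vecMul_transpose, hE, Matrix.vecMul_neg]
      nth_rewrite 1 [h6]
      rw [neg_dotProduct, ← Matrix.dotProduct_mulVec]
      simp [Matrix.mulVec_mulVec, Matrix.mul_assoc]
    have h4 := hG.posSemidef.dotProduct_mulVec_nonneg x
    simp only [star_trivial] at h2 h4
    rw [h3, h1, Matrix.smul_mulVec, dotProduct_smul, smul_eq_mul] at h2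
    have h5 : 0 ≤ -(1 * (√G.det)⁻¹ * pfaff E) := by nlinarith
    nlinarith [mul_nonneg h5 h4]
  exact Matrix.ext_of_mulVec_single fun i => by rw [key, Matrix.zero_mulVec]

lemma sum_smul_ee (x : V4) : ∑ i, x i • ee i = x := by
  ext j
  simp [ee, Pi.single_apply]

lemma apply_eq_vecMul {B : V4 → V4 → ℝ} (hadd : ∀ x y z, B (x + y) z = B x z + B y z)
    (hsmul : ∀ (a : ℝ) (x y : V4), B (a • x) y = a * B x y) (x : V4) (k : Fin 4) :
    B x (ee k) = (x ᵥ* gram B) k := by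
  conv_lhs => rw [← sum_smul_ee x]
  simp [Fin.sum_univ_four, hadd, hsmul, gram, Matrix.vecMul, dotProduct]

lemma IsAltForm.transpose_gram {F : V4 → V4 → ℝ} (hF : IsAltForm F) : (gram F)ᵀ = -gram F := by
  ext i j
  exact hF.skew _ _

lemma IsInnerProduct.apply_eq {g : V4 → V4 → ℝ} (hg : IsInnerProduct g) (x y : V4) :
    g x y = x ⬝ᵥ (gram g *ᵥ y) := by
  rw [hg.symm, ← sum_smul_ee y]
  simp only [Fin.sum_univ_four, hg.add_left, hg.smul_left]
  simp only [hg.symm _ x, apply_eq_vecMul hg.add_left hg.smul_left, Matrix.dotProduct_mulVec]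
  simp [dotProduct, Fin.sum_univ_four, ee]
  ring

lemma IsInnerProduct.posDef_gram {g : V4 → V4 → ℝ} (hg : IsInnerProduct g) : (gram g).PosDef := by
  refine Matrix.PosDef.of_dotProduct_mulVec_pos ?_ fun x hx => ?_
  · ext i j
    exact hg.symm _ _
  · simpa [← hg.apply_eq] using hg.pos x hx

/-- The 2-form `eⁱ ∧ eʲ`. -/
def coordForm (i j : Fin 4) (x y : V4) : ℝ := x i * y j - x j * y i

lemma isAltForm_coordForm (i j : Fin 4) : IsAltForm (coordForm i j) := by
  constructor <;> intros <;> simp [coordForm] <;> ring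

lemma formInner_coordForm (g : V4 → V4 → ℝ) {F : V4 → V4 → ℝ} (hF : IsAltForm F) (i j : Fin 4) :
    formInner g (coordForm i j) F = (ginv g * gram F * (ginv g)ᵀ) i j := by
  have h : ∀ k l, F (ee k) (ee l) = gram F k l := fun _ _ => rfl
  have hs := eq_of_skew hF.transpose_gram
  simp only [formInner, h]
  rw [hs]
  fin_cases i <;> fin_cases j <;>
    simp [coordForm, ee, Fin.sum_univ_four, Matrix.mul_apply] <;> ring

lemma IsHodgeStar.gram_eq {g F sF : V4 → V4 → ℝ} (hg : IsInnerProduct g) (hF : IsAltForm F)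
    (h : IsHodgeStar g F sF) :
    gram sF = √(gram g).det • skewDual ((gram g)⁻¹ * gram F * (gram g)⁻¹) := by
  have hP : ((gram g)⁻¹)ᵀ = (gram g)⁻¹ := hg.posDef_gram.inv.isHermitian
  have hv : vol g (ee 0) (ee 1) (ee 2) (ee 3) = √(gram g).det := by
    have : (Matrix.of fun i j => ![ee 0, ee 1, ee 2, ee 3] i j) = 1 := by
      ext i j
      fin_cases i <;> fin_cases j <;> simp [ee]
    rw [vol, this, Matrix.det_one, mul_one]
  have key : ∀ i j, wedge22 (coordForm i j) sF (ee 0) (ee 1) (ee 2) (ee 3)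
      = √(gram g).det * ((gram g)⁻¹ * gram F * (gram g)⁻¹) i j := by
    intro i j
    rw [h.2 _ (isAltForm_coordForm i j), formInner_coordForm g hF, hv, ginv, hP, mul_comm]
  have k01 := key 0 1
  have k02 := key 0 2
  have k03 := key 0 3
  have k12 := key 1 2
  have k13 := key 1 3
  have k23 := key 2 3
  have hs : ∀ k l, sF (ee k) (ee l) = gram sF k l := fun _ _ => rfl
  simp only [wedge22, hs, coordForm] at k01 k02 k03 k12 k13 k23
  simp [ee] at k01 k02 k03 k12 k13 k23
  rw [eq_of_skew h.1.transpose_gram]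
  ext i j
  fin_cases i <;> fin_cases j <;> simp [skewDual] <;> linarith

lemma pfaff_nonpos_of_closed {A : Matrix (Fin 4) (Fin 4) ℝ} (h01 : A 0 1 = 0)
    (h13 : A 1 3 = A 0 2) (h03 : A 0 3 = -A 1 2) : pfaff A ≤ 0 := by
  rw [pfaff, h01, h13, h03]
  nlinarith [sq_nonneg (A 0 2), sq_nonneg (A 1 2)]

lemma IsClosedForm.gram_apply {F : V4 → V4 → ℝ} (hF : IsAltForm F) (h : IsClosedForm brA412 F) :
    gram F 0 1 = 0 ∧ gram F 1 3 = gram F 0 2 ∧ gram F 0 3 = -gram F 1 2 := by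
  have hz : ∀ y, F 0 y = 0 := fun y => by simpa using hF.smul_left 0 0 y
  have hn : ∀ x y, F (-x) y = -F x y := fun x y => by simpa using hF.smul_left (-1) x y
  have b01 : brA412 (ee 0) (ee 1) = 0 := by simp [brA412, ee]
  have b02 : brA412 (ee 0) (ee 2) = ee 0 := by simp [brA412, ee]
  have b03 : brA412 (ee 0) (ee 3) = -ee 1 := by simp [brA412, ee]
  have b12 : brA412 (ee 1) (ee 2) = ee 1 := by simp [brA412, ee]
  have b13 : brA412 (ee 1) (ee 3) = ee 0 := by simp [brA412, ee]
  have b23 : brA412 (ee 2) (ee 3) = 0 := by simp [brA412, ee]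
  have h1 := h (ee 0) (ee 1) (ee 2)
  have h2 := h (ee 0) (ee 2) (ee 3)
  have h3 := h (ee 1) (ee 2) (ee 3)
  simp only [cdiff, b01, b02, b03, b12, b13, b23, hz, hn] at h1 h2 h3
  have h4 := hF.skew (ee 0) (ee 1)
  simp only [gram, Matrix.of_apply]
  refine ⟨by linarith, by linarith, ?_⟩
  linarith

/-- If `F ∘ F` is a multiple of the metric then its trace-free part vanishes. -/
lemma FF0_eq_zero {g F : V4 → V4 → ℝ} (hg : IsInnerProduct g) (hF : IsAltForm F) {c : ℝ}
    (h : gram F * (gram g)⁻¹ * gram F = c • gram g) (x y : V4) : FF0 g F x y = 0 := by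
  have hu : IsUnit (gram g).det := hg.posDef_gram.det_pos.ne'.isUnit
  have hf : ∀ x, fhat g F x = x ᵥ* (gram F * (gram g)⁻¹) := by
    intro x
    rw [← Matrix.vecMul_vecMul]
    ext m
    simp only [fhat, apply_eq_vecMul hF.add_left hF.smul_left]
    rfl
  have hff : ∀ x, fhat g F (fhat g F x) = c • x := by
    intro x
    rw [hf, hf, Matrix.vecMul_vecMul, ← Matrix.mul_assoc, h, Matrix.smul_mul,
      Matrix.mul_nonsing_inv _ hu, Matrix.vecMul_smul, Matrix.vecMul_one]
  simp only [FF0, hff, hg.smul_left]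
  simp [ee]

/-- `𝒜₄,₁₂` admits no left-invariant non-Einstein solution to the Einstein--Maxwell equations. -/
theorem stmt18 :
    ∀ g F : V4 → V4 → ℝ, IsInnerProduct g → IsAltForm F →
      IsEMSolution (brA412) g F → IsEinstein (brA412) g := by
  rintro g F hg hF ⟨hcl, ⟨sF, hsF, hscl⟩, hRic⟩ x y
  have hG := hg.posDef_gram
  have hS := hsF.gram_eq hg hF
  have hF' := hodge_involutive hG hF.transpose_gram hS
  obtain ⟨p1, p2, p3⟩ := hcl.gram_apply hF
  obtain ⟨q1, q2, q3⟩ := hscl.gram_apply hsF.1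
  have hsum : gram F + gram sF = 0 := by
    refine eq_zero_of_star_eq_of_pfaff_nonpos hG ?_ ?_ (pfaff_nonpos_of_closed ?_ ?_ ?_)
    · rw [Matrix.transpose_add, hF.transpose_gram, hsF.1.transpose_gram, neg_add]
    · rw [Matrix.mul_add, Matrix.add_mul, skewDual_add, smul_add, ← hF', ← hS, add_comm]
    · simp [p1, q1]
    · simp [p2, q2]
    · simp [p3, q3, add_comm]
  have hE : (-1 : ℝ) • gram F = √(gram g).det • skewDual ((gram g)⁻¹ * gram F * (gram g)⁻¹) := by
    rw [← hS, neg_one_smul, neg_eq_of_add_eq_zero_right hsum]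
  rw [hRic, FF0_eq_zero hg hF (mul_inv_mul_self_of_star_eq hG hF.transpose_gram hE), neg_zero]
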